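/- arXiv:2104.05368 — 2 statements merged into one kernel-verified Lean document; each statement's English description precedes it below -/
import Mathlib

section
/- Let σ_s > 0, w > 0, A > 0, and let R be a nonnegative random variable following a Rayleigh distribution with scale parameter σ_s, i.e., P(R > r) = exp(−r²/(2σ_s²)) for all r ≥ 0. Define the pointing-error gain H = A·exp(−2R²/w²) and set ζ² = w²/(4σ_s²). Then for every x with 0 < x ≤ A, P(H ≤ x) = (x/A)^{ζ²}. Consequently H has probability density f(h) = (ζ²/A^{ζ²})·h^{ζ²−1} on (0, A]. -/
open MeasureTheory ProbabilityTheory Real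

/-- A continuous survival function also gives the probability of the closed upper tail. -/
theorem measure_le_eq_of_continuous_survival
    {Ω : Type*} [MeasurableSpace Ω] (P : Measure Ω) [IsProbabilityMeasure P]
    (R : Ω → ℝ) (hRnonneg : ∀ ω, 0 ≤ R ω) (S : ℝ → ENNReal) (hS : Continuous S)
    (hS0 : S 0 = 1) (hsurv : ∀ r : ℝ, 0 ≤ r → P {ω | r < R ω} = S r)
    (r : ℝ) (hr : 0 ≤ r) : P {ω | r ≤ R ω} = S r := by
  rcases hr.eq_or_lt with rfl | hr'
  · simp [hRnonneg, hS0]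
  · apply le_antisymm
    · have hlim : Filter.Tendsto S (nhdsWithin r (Set.Iio r)) (nhds (S r)) :=
        hS.continuousAt.tendsto.mono_left nhdsWithin_le_nhds
      refine ge_of_tendsto hlim ?_
      filter_upwards [Ioo_mem_nhdsLT hr'] with s hs
      rw [← hsurv s hs.1.le]
      exact measure_mono fun ω hω => lt_of_lt_of_le hs.2 hω
    · rw [← hsurv r hr]
      exact measure_mono fun ω (hω : r < R ω) => (hω.le : r ≤ R ω)

/-- If `R` is a nonnegative Rayleigh random variable with scale `σs`
(`P(R > r) = exp(−r²/(2σs²))` for all `r ≥ 0`), and the pointing-error gain is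
`H = A·exp(−2R²/w²)` with `ζ² = w²/(4σs²)`, then for every `0 < x ≤ A`,
`P(H ≤ x) = (x/A)^(ζ²)`. -/
theorem pointing_error_gain_cdf
    {Ω : Type*} [MeasurableSpace Ω] (P : Measure Ω) [IsProbabilityMeasure P]
    (σs w A : ℝ) (hσs : 0 < σs) (hw : 0 < w) (hA : 0 < A)
    (R : Ω → ℝ) (hRmeas : Measurable R) (hRnonneg : ∀ ω, 0 ≤ R ω)
    (hRayleigh : ∀ r : ℝ, 0 ≤ r →
      P {ω | r < R ω} = ENNReal.ofReal (Real.exp (-(r ^ 2) / (2 * σs ^ 2)))) :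
    ∀ x : ℝ, 0 < x → x ≤ A →
      P {ω | A * Real.exp (-2 * (R ω) ^ 2 / w ^ 2) ≤ x}
        = ENNReal.ofReal ((x / A) ^ (w ^ 2 / (4 * σs ^ 2))) := by
  intro x hx hxA
  have hlog : 0 ≤ Real.log (A / x) := Real.log_nonneg ((one_le_div hx).2 hxA)
  have hlog' : Real.log (A / x) = -Real.log (x / A) := by
    rw [← Real.log_inv, inv_div]
  have hnn : 0 ≤ w ^ 2 / 2 * Real.log (A / x) := by positivity
  have hset : {ω | A * Real.exp (-2 * (R ω) ^ 2 / w ^ 2) ≤ x}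
      = {ω | √(w ^ 2 / 2 * Real.log (A / x)) ≤ R ω} := by
    ext ω
    simp only [Set.mem_ofPred_eq]
    rw [Real.sqrt_le_left (hRnonneg ω), mul_comm A, ← le_div_iff₀ hA,
      ← Real.le_log_iff_exp_le (by positivity), hlog', div_le_iff₀ (by positivity)]
    constructor <;> intro h <;> linarith
  rw [hset, measure_le_eq_of_continuous_survival P R hRnonneg
    (fun r => ENNReal.ofReal (Real.exp (-(r ^ 2) / (2 * σs ^ 2))))
    (ENNReal.continuous_ofReal.comp (by fun_prop)) (by simp) hRayleigh _ (Real.sqrt_nonneg _),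
    Real.sq_sqrt hnn, Real.rpow_def_of_pos (by positivity), hlog']
  congr 2
  field_simp
  ring
end

section
/- Fix constants C > 0 and k > 0, and for Z > 0 define the Rytov variance x(Z) = 1.23·C·k^{7/6}·Z^{11/6} and the small-scale turbulence parameter β(Z) = [exp( 0.51·x(Z) / (1 + 0.69·x(Z)^{6/5})^{5/6} ) − 1]^{−1}. Then β is strictly decreasing on (0, ∞): if 0 < Z₁ < Z₂ then β(Z₁) > β(Z₂). -/
open Real

theorem div_one_add_mul_rpow_strictMonoOn {a p : ℝ} (ha : 0 ≤ a) (hp : 0 < p) :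
    StrictMonoOn (fun x : ℝ => x / (1 + a * x ^ p) ^ p⁻¹) (Set.Ioi 0) := by
  have key : ∀ x : ℝ, 0 < x → x / (1 + a * x ^ p) ^ p⁻¹ = (x ^ p / (1 + a * x ^ p)) ^ p⁻¹ := by
    intro x hx
    rw [div_rpow (by positivity) (by positivity), rpow_rpow_inv hx.le hp.ne']
  intro x hx y hy hxy
  rw [Set.mem_Ioi] at hx hy
  have hlt : x ^ p < y ^ p := rpow_lt_rpow hx.le hxy hp
  simp only [key x hx, key y hy]
  refine rpow_lt_rpow (by positivity) ?_ (by positivity)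
  rw [div_lt_div_iff₀ (by positivity) (by positivity)]
  linarith

/-- With Rytov variance `x(Z) = 1.23·C·k^(7/6)·Z^(11/6)` and small-scale
turbulence parameter `β(Z) = [exp(0.51·x(Z)/(1 + 0.69·x(Z)^(6/5))^(5/6)) − 1]⁻¹`, the
function `β` is strictly decreasing on `(0, ∞)`: if `0 < Z₁ < Z₂` then `β(Z₁) > β(Z₂)`. -/
theorem small_scale_parameter_strictly_decreasing
    (C k : ℝ) (hC : 0 < C) (hk : 0 < k)
    (x β : ℝ → ℝ)
    (hx : ∀ Z : ℝ, x Z = 1.23 * C * k ^ ((7 : ℝ) / 6) * Z ^ ((11 : ℝ) / 6))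
    (hβ : ∀ Z : ℝ, β Z =
      (Real.exp (0.51 * x Z / (1 + 0.69 * (x Z) ^ ((6 : ℝ) / 5)) ^ ((5 : ℝ) / 6)) - 1)⁻¹) :
    ∀ Z₁ Z₂ : ℝ, 0 < Z₁ → Z₁ < Z₂ → β Z₂ < β Z₁ := by
  intro Z₁ Z₂ h₁ h₁₂
  have hx₁ : 0 < x Z₁ := by rw [hx]; positivity
  have hx₁₂ : x Z₁ < x Z₂ := by
    rw [hx, hx]
    gcongr
  have hmono := div_one_add_mul_rpow_strictMonoOn (a := 0.69) (p := 6 / 5)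
    (by norm_num) (by norm_num) hx₁ (hx₁.trans hx₁₂) hx₁₂
  simp only [inv_div] at hmono
  rw [hβ, hβ]
  refine inv_strictAnti₀ (sub_pos.2 (one_lt_exp_iff.2 (by positivity))) ?_
  gcongr ?_ - 1
  rw [exp_lt_exp, mul_div_assoc, mul_div_assoc]
  gcongr
end
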